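/- There is a universal constant C > 0 such that the following holds. Let 2 ≤ q ≤ m, let v be a 1-Lipschitz q-partitioning valuation over [m], let S ⊆ [m] be a random set in which each element appears independently, and let Med[v(S)] be a median of v(S). Then E[v(S)] ≤ (1 + C/log₂ q)·Med[v(S)] + C·log₂ q. -/

import Mathlib

open Finset

/-- A normalized monotone valuation `v : 2^[m] → ℝ≥0`. -/
def IsValuation (m : ℕ) (v : Finset (Fin m) → ℝ) : Prop :=
  v ∅ = 0 ∧ (∀ S T : Finset (Fin m), S ⊆ T → v S ≤ v T) ∧ ∀ S, 0 ≤ v S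

/-- A fractional cover of `[q]`. -/
def IsFractionalCover (q : ℕ) (α : Finset (Fin q) → ℝ) : Prop :=
  (∀ T, 0 ≤ α T) ∧
    ∀ j : Fin q, 1 ≤ ∑ T ∈ Finset.univ.filter (fun T : Finset (Fin q) => j ∈ T), α T

/-- `P` is a partition of `S` into `q` (possibly empty) pairwise disjoint parts. -/
def IsPartitionInto (m q : ℕ) (S : Finset (Fin m)) (P : Fin q → Finset (Fin m)) : Prop :=
  (∀ i j : Fin q, i ≠ j → Disjoint (P i) (P j)) ∧ Finset.univ.biUnion P = S

/-- `v` is `q`-partitioning, i.e. `v ∈ Q(q,[m])`. -/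
def IsQPartitioning (m q : ℕ) (v : Finset (Fin m) → ℝ) : Prop :=
  ∀ S P, IsPartitionInto m q S P → ∀ α, IsFractionalCover q α →
    v S ≤ ∑ T : Finset (Fin q), α T * v (T.biUnion P)

open scoped Classical

/-- Probability that the random set (each `j` included independently with probability `p j`)
equals `S`. -/
noncomputable def prodWeight (m : ℕ) (p : Fin m → ℝ) (S : Finset (Fin m)) : ℝ :=
  (∏ j ∈ S, p j) * ∏ j ∈ Sᶜ, (1 - p j)

/-- `v` is 1-Lipschitz: all marginal values are at most 1. -/
def IsLipschitzVal (m : ℕ) (v : Finset (Fin m) → ℝ) : Prop :=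
  ∀ (S : Finset (Fin m)) (i : Fin m), v (insert i S) - v S ≤ 1

/-- The expectation of `W` under the product of the weights `w i`. -/
noncomputable def prodExp {n : ℕ} {α : Type*} [Fintype α] (w : Fin n → α → ℝ)
    (W : (Fin n → α) → ℝ) : ℝ :=
  ∑ x, (∏ i, w i (x i)) * W x

lemma prodExp_succ {n : ℕ} {α : Type*} [Fintype α] (w : Fin (n + 1) → α → ℝ)
    (W : (Fin (n + 1) → α) → ℝ) :
    prodExp w W = ∑ a, w 0 a * prodExp (fun i => w i.succ) (fun x => W (Fin.cons a x)) := by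
  unfold prodExp
  rw [← (Fin.consEquiv fun _ => α).sum_comp, Fintype.sum_prod_type]
  simp [Fin.consEquiv, Fin.prod_univ_succ, mul_sum, mul_assoc]

lemma prodExp_nonneg {n : ℕ} {α : Type*} [Fintype α] {w : Fin n → α → ℝ}
    (hw : ∀ i a, 0 ≤ w i a) {W : (Fin n → α) → ℝ} (hW : ∀ x, 0 ≤ W x) : 0 ≤ prodExp w W :=
  sum_nonneg fun x _ => mul_nonneg (prod_nonneg fun i _ => hw i _) (hW x)

lemma prodExp_mono {n : ℕ} {α : Type*} [Fintype α] {w : Fin n → α → ℝ}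
    (hw : ∀ i a, 0 ≤ w i a) {V W : (Fin n → α) → ℝ} (h : ∀ x, V x ≤ W x) :
    prodExp w V ≤ prodExp w W :=
  sum_le_sum fun x _ => mul_le_mul_of_nonneg_left (h x) (prod_nonneg fun i _ => hw i _)

lemma one_le_pow_mul_prod_erase {s : ℕ} (u : Fin s → ℝ) (hu0 : ∀ j, 0 ≤ u j)
    (hU : ∑ j, u j ≤ 1 / 3) (k : Fin s) (hk : ∀ j, u j ≤ u k) :
    1 ≤ (1 + (∑ j, u j) / s) ^ s * ∏ j ∈ univ.erase k, (1 - u j) := by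
  have hs : (0 : ℝ) < s := by
    have := k.pos
    exact_mod_cast this
  set U := ∑ j, u j with hUdef
  have hU0 : 0 ≤ U := sum_nonneg fun j _ => hu0 j
  set z := U / s with hz
  have hz0 : 0 ≤ z := by positivity
  have hsz : s * z = U := by rw [hz]; field_simp
  have hzk : z ≤ u k := by
    rw [hz, div_le_iff₀ hs]
    have := sum_le_card_nsmul univ u (u k) fun j _ => hk j
    simpa [mul_comm] using this
  have huU : ∀ j, u j ≤ U := fun j => single_le_sum (fun i _ => hu0 i) (mem_univ j)
  have hfac : ∀ j, Real.exp (-(u j + 2 * u k * u j)) ≤ 1 - u j := fun j => by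
    have h1 : 0 < 1 - u j := by linarith [huU j]
    have h2 : 1 / (1 - u j) ≤ Real.exp (u j + 2 * u k * u j) := by
      refine le_trans ?_ (Real.add_one_le_exp _)
      rw [div_le_iff₀ h1]
      nlinarith [mul_nonneg (hu0 j) (hu0 k), mul_nonneg (hu0 j) (sub_nonneg.2 (hk j)),
        mul_nonneg (mul_nonneg (hu0 j) (hu0 k)) (sub_nonneg.2 ((huU j).trans hU))]
    rw [Real.exp_neg, inv_le_comm₀ (Real.exp_pos _) h1]
    simpa using h2
  have hz1 : Real.exp (z - z ^ 2) ≤ 1 + z := by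
    have h2 : 1 - (z - z ^ 2) ≤ Real.exp (-(z - z ^ 2)) := by
      linarith [Real.add_one_le_exp (-(z - z ^ 2))]
    have h3 : 1 / (1 + z) ≤ Real.exp (-(z - z ^ 2)) := by
      refine le_trans ?_ h2
      rw [div_le_iff₀ (by linarith)]
      nlinarith [pow_nonneg hz0 3]
    rw [Real.exp_neg, one_div] at h3
    exact (inv_le_inv₀ (by linarith) (Real.exp_pos _)).1 h3
  have hsum : ∑ j ∈ univ.erase k, u j = U - u k := by
    rw [hUdef, ← add_sum_erase univ u (mem_univ k)]; ring
  calc (1 : ℝ) ≤ Real.exp (s * (z - z ^ 2) + ∑ j ∈ univ.erase k, -(u j + 2 * u k * u j)) := by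
        apply Real.one_le_exp
        rw [sum_neg_distrib, sum_add_distrib, ← mul_sum, hsum]
        have : (s : ℝ) * (z - z ^ 2) = U - U * z := by rw [← hsz]; ring
        rw [this]
        nlinarith [mul_nonneg hU0 (sub_nonneg.2 hzk), mul_nonneg (hu0 k) (sub_nonneg.2 hU),
          mul_nonneg (hu0 k) (hu0 k)]
    _ ≤ _ := by
        rw [Real.exp_add, Real.exp_nat_mul, Real.exp_sum]
        gcongr with j _
        exact hfac j

lemma add_mean_le_two {s : ℕ} (hs : 0 < s) {N : ℝ} (hN : N ≤ 1 + 1 / (3 * s)) (g : Fin s → ℝ)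
    (hg : ∀ j, g j ≤ 1)
    (h : ∀ k, N ^ s * ∏ j ∈ univ.erase k, g j ≤ 1) : N + (∑ j, g j) / s ≤ 2 := by
  have hs' : (0 : ℝ) < s := by exact_mod_cast hs
  have : Nonempty (Fin s) := ⟨⟨0, hs⟩⟩
  have hsum : (∑ j, g j) / s = 1 - (∑ j, (1 - g j)) / s := by
    simp [sum_sub_distrib]; field_simp; ring
  rw [hsum]
  by_contra! hlt
  have hu0 : ∀ j, 0 ≤ 1 - g j := fun j => by linarith [hg j]
  have hU0 : 0 ≤ ∑ j, (1 - g j) := sum_nonneg fun j _ => hu0 j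
  have hU : ∑ j, (1 - g j) ≤ 1 / 3 := by
    have h1 : (∑ j, (1 - g j)) / s ≤ (1 / 3) / s := by
      rw [div_div]; linarith
    exact (div_le_div_iff_of_pos_right hs').1 h1
  obtain ⟨k, hk⟩ := Finite.exists_max fun j => 1 - g j
  have h1 := one_le_pow_mul_prod_erase (fun j => 1 - g j) hu0 hU k hk
  simp only [sub_sub_cancel] at h1
  have hpos : 0 < ∏ j ∈ univ.erase k, g j := prod_pos fun j _ => by
    have := single_le_sum (fun i _ => hu0 i) (mem_univ j)
    linarith
  have h2 : (1 + (∑ j, (1 - g j)) / s) ^ s < N ^ s :=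
    pow_lt_pow_left₀ (by linarith) (by positivity) hs.ne'
  have := mul_lt_mul_of_pos_right h2 hpos
  linarith [h k]

lemma prod_le_mean_pow {s : ℕ} (hs : 0 < s) (g : Fin s → ℝ) (hg : ∀ j, 0 ≤ g j) :
    ∏ j, g j ≤ ((∑ j, g j) / s) ^ s := by
  have := Real.geom_mean_le_arith_mean univ (fun _ => 1) g (fun _ _ => zero_le_one)
    (by simpa using hs) fun j _ => hg j
  simp only [Real.rpow_one, sum_const, card_univ, Fintype.card_fin, nsmul_eq_mul, mul_one,
    one_mul] at this
  have h0 : 0 ≤ ∏ j, g j := prod_nonneg fun j _ => hg j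
  have h2 := pow_le_pow_left₀ (by positivity) this s
  rwa [Real.rpow_inv_natCast_pow h0 hs.ne'] at h2

/-- The number of coordinates of `x` at which at least two of the points `y j` differ from `x`. -/
noncomputable def doubleMismatch {n s : ℕ} {α : Type*} (x : Fin n → α) (y : Fin s → Fin n → α) :
    ℕ :=
  #{i | ¬ ∃ k, ∀ j, j ≠ k → y j i = x i}

lemma doubleMismatch_cons_le {n s : ℕ} {α : Type*} (a : α) (x : Fin n → α) (b : Fin s → α)
    (y : Fin s → Fin n → α) :
    doubleMismatch (Fin.cons a x : Fin (n + 1) → α) (fun j => Fin.cons (b j) (y j)) ≤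
      doubleMismatch x y + 1 := by
  unfold doubleMismatch
  rw [Fin.card_filter_univ_succ]
  simp only [Fin.cons_succ, Fin.cons_zero]
  split_ifs <;> simp

lemma doubleMismatch_cons {n s : ℕ} {α : Type*} (a : α) (x : Fin n → α) (b : Fin s → α)
    (y : Fin s → Fin n → α) (k : Fin s) (hb : ∀ j, j ≠ k → b j = a) :
    doubleMismatch (Fin.cons a x : Fin (n + 1) → α) (fun j => Fin.cons (b j) (y j)) =
      doubleMismatch x y := by
  unfold doubleMismatch
  rw [Fin.card_filter_univ_succ]
  simp only [Fin.cons_succ, Fin.cons_zero]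
  rw [if_neg (not_not.2 ⟨k, hb⟩)]

/-- A Talagrand-type inequality for control by several points, each coordinate being allowed
one mismatch. -/
theorem prodExp_pow_mul_prod_le_one {s : ℕ} (hs : 0 < s) {α : Type*} [Fintype α] (n : ℕ)
    (w : Fin n → α → ℝ) (hw0 : ∀ i a, 0 ≤ w i a) (hw1 : ∀ i, ∑ a, w i a = 1)
    (A : Fin s → Set (Fin n → α)) (W : (Fin n → α) → ℝ) (hW0 : ∀ x, 0 ≤ W x)
    (hW : ∀ x y, (∀ j, y j ∈ A j) → W x ≤ (1 + 1 / (3 * s : ℝ)) ^ doubleMismatch x y) :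
    prodExp w W ^ s * ∏ j, prodExp w ((A j).indicator 1) ≤ 1 := by
  have hs' : (0 : ℝ) < s := by exact_mod_cast hs
  have hind0 : ∀ {n : ℕ} (B : Set (Fin n → α)) x, (0 : ℝ) ≤ B.indicator 1 x := fun B x =>
    Set.indicator_nonneg (fun _ _ => zero_le_one) x
  induction n with
  | zero =>
    have hE : ∀ V : (Fin 0 → α) → ℝ, prodExp w V = V default := fun V => by
      rw [prodExp, Fintype.sum_unique]
      simp
    simp only [hE]
    by_cases hA : ∀ j, default ∈ A j
    · have h1 := hW default (fun _ => default) hA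
      have h2 : doubleMismatch (default : Fin 0 → α) (fun _ : Fin s => default) = 0 := by
        simp [doubleMismatch]
      rw [h2, pow_zero] at h1
      have h3 : ∀ j, (A j).indicator (1 : (Fin 0 → α) → ℝ) default = 1 := fun j => by
        simp [hA j]
      simpa [h3] using pow_le_one₀ (hW0 _) h1
    · push Not at hA
      obtain ⟨j, hj⟩ := hA
      rw [prod_eq_zero (mem_univ j) (by simp [hj])]
      simp
  | succ n ih =>
    set lam : ℝ := 1 + 1 / (3 * s) with hlam
    have hlam0 : 0 < lam := by positivity
    let w' : Fin n → α → ℝ := fun i => w i.succ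
    have hw'0 : ∀ i a, 0 ≤ w' i a := fun i a => hw0 _ a
    have hw'1 : ∀ i, ∑ a, w' i a = 1 := fun i => hw1 _
    let fib : α → Fin s → Set (Fin n → α) := fun a j => {x | Fin.cons a x ∈ A j}
    let proj : Fin s → Set (Fin n → α) := fun j => {x | ∃ a, (Fin.cons a x : Fin (n + 1) → α) ∈ A j}
    let b : Fin s → ℝ := fun j => prodExp w' ((proj j).indicator 1)
    let c : α → Fin s → ℝ := fun a j => prodExp w' ((fib a j).indicator 1)
    let M : α → ℝ := fun a => prodExp w' fun x => W (Fin.cons a x)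
    have hb0 : ∀ j, 0 ≤ b j := fun j => prodExp_nonneg hw'0 (hind0 _)
    have hc0 : ∀ a j, 0 ≤ c a j := fun a j => prodExp_nonneg hw'0 (hind0 _)
    have hM0 : ∀ a, 0 ≤ M a := fun a => prodExp_nonneg hw'0 fun x => hW0 _
    have hcb : ∀ a j, c a j ≤ b j := fun a j => prodExp_mono hw'0 fun x =>
      Set.indicator_le_indicator_of_subset (show fib a j ⊆ proj j from fun x hx => ⟨a, hx⟩)
        (fun _ => zero_le_one) x
    have hEA : ∀ j, prodExp w ((A j).indicator 1) = ∑ a, w 0 a * c a j := fun j => by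
      rw [prodExp_succ]; rfl
    have hEW : prodExp w W = ∑ a, w 0 a * M a := prodExp_succ w W
    simp only [hEA, hEW]
    by_cases hbz : ∃ j, b j = 0
    · obtain ⟨j, hj⟩ := hbz
      have hcz : ∀ a, c a j = 0 := fun a => le_antisymm (hj ▸ hcb a j) (hc0 a j)
      rw [prod_eq_zero (mem_univ j) (by simp [hcz])]
      simp
    push Not at hbz
    have hbpos : ∀ j, 0 < b j := fun j => lt_of_le_of_ne (hb0 j) (hbz j).symm
    have hprojbound : ∀ a, (M a / lam) ^ s * ∏ j, b j ≤ 1 := fun a => by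
      have h1 := ih w' hw'0 hw'1 proj (fun x => W (Fin.cons a x) / lam)
        (fun x => div_nonneg (hW0 _) hlam0.le) fun x y hy => by
          choose d hd using hy
          rw [div_le_iff₀ hlam0, ← pow_succ]
          refine (hW _ _ hd).trans ?_
          exact pow_le_pow_right₀ (by rw [hlam]; linarith [show 0 < 1 / (3 * (s : ℝ)) by positivity])
            (doubleMismatch_cons_le a x d y)
      have h2 : prodExp w' (fun x => W (Fin.cons a x) / lam) = M a / lam := by
        simp only [M, prodExp, mul_div_assoc', sum_div]
      rwa [h2] at h1
    have hfibbound : ∀ a k, M a ^ s * (b k * ∏ j ∈ univ.erase k, c a j) ≤ 1 := fun a k => by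
      have h1 := ih w' hw'0 hw'1 (fun j => if j = k then proj j else fib a j)
        (fun x => W (Fin.cons a x)) (fun x => hW0 _) fun x y hy => by
          have hy' : ∀ j, ∃ d, (j ≠ k → d = a) ∧ (Fin.cons d (y j) : Fin (n + 1) → α) ∈ A j := by
            intro j
            have := hy j
            split_ifs at this with hjk
            · obtain ⟨d, hd⟩ := this
              exact ⟨d, fun h => absurd hjk h, hd⟩
            · exact ⟨a, fun _ => rfl, this⟩
          choose d hda hd using hy'
          refine (hW _ _ hd).trans_eq ?_
          rw [doubleMismatch_cons a x d y k hda]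
      rw [← mul_prod_erase univ _ (mem_univ k)] at h1
      simp only [if_true] at h1
      convert h1 using 3
      refine prod_congr rfl fun j hj => ?_
      rw [if_neg (ne_of_mem_erase hj)]
    obtain ⟨β, hβ0, hβ⟩ : ∃ β : ℝ, 0 < β ∧ β ^ s = ∏ j, b j :=
      ⟨(∏ j, b j) ^ ((s : ℝ)⁻¹), Real.rpow_pos_of_pos (prod_pos fun j _ => hbpos j) _,
        Real.rpow_inv_natCast_pow (prod_nonneg fun j _ => hb0 j) hs.ne'⟩
    have hpt : ∀ a, M a * β + (∑ j, c a j / b j) / s ≤ 2 := fun a => by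
      refine add_mean_le_two hs ?_ _ (fun j => div_le_one_of_le₀ (hcb a j) (hb0 j)) fun k => ?_
      · have h1 := hprojbound a
        rw [← hβ, ← mul_pow] at h1
        have h2 := (pow_le_one_iff_of_nonneg
          (mul_nonneg (div_nonneg (hM0 a) hlam0.le) hβ0.le) hs.ne').1 h1
        rw [div_mul_eq_mul_div, div_le_one hlam0] at h2
        exact h2
      · have h1 := hfibbound a k
        rw [mul_pow, hβ, prod_div_distrib, ← mul_prod_erase univ b (mem_univ k)]
        have h2 : ∏ j ∈ univ.erase k, b j ≠ 0 := prod_ne_zero_iff.2 fun j _ => hbz j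
        calc _ = M a ^ s * (b k * ∏ j ∈ univ.erase k, c a j) := by field_simp
          _ ≤ 1 := h1
    set E := ∑ a, w 0 a * M a with hE
    let G : Fin s → ℝ := fun j => (∑ a, w 0 a * c a j) / b j
    have hG0 : ∀ j, 0 ≤ G j := fun j =>
      div_nonneg (sum_nonneg fun a _ => mul_nonneg (hw0 _ _) (hc0 _ _)) (hb0 j)
    have hE0 : 0 ≤ E := sum_nonneg fun a _ => mul_nonneg (hw0 _ _) (hM0 _)
    have hsum : E * β + (∑ j, G j) / s ≤ 2 := by
      calc E * β + (∑ j, G j) / s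
          = ∑ a, w 0 a * (M a * β + (∑ j, c a j / b j) / s) := by
            have : ∑ j, G j = ∑ a, w 0 a * ∑ j, c a j / b j := by
              simp only [G, sum_div, mul_sum, mul_div_assoc]
              exact sum_comm
            simp only [this, hE, mul_add, sum_add_distrib, sum_mul, sum_div, mul_assoc,
              mul_div_assoc]
        _ ≤ ∑ a, w 0 a * 2 := sum_le_sum fun a _ => mul_le_mul_of_nonneg_left (hpt a) (hw0 _ _)
        _ = 2 := by rw [← sum_mul, hw1, one_mul]
    have hGm : 0 ≤ (∑ j, G j) / s := div_nonneg (sum_nonneg fun j _ => hG0 j) hs'.le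
    calc E ^ s * ∏ j, ∑ a, w 0 a * c a j = (E * β) ^ s * ∏ j, G j := by
          rw [mul_pow, hβ, prod_div_distrib]
          have : ∏ j, b j ≠ 0 := prod_ne_zero_iff.2 fun j _ => hbz j
          field_simp
      _ ≤ (E * β) ^ s * ((∑ j, G j) / s) ^ s := by
          gcongr
          exact prod_le_mean_pow hs G hG0
      _ = (E * β * ((∑ j, G j) / s)) ^ s := (mul_pow _ _ _).symm
      _ ≤ 1 := by
          apply pow_le_one₀ (by positivity)
          have hEβ : 0 ≤ E * β := by positivity
          generalize E * β = e at *
          generalize (∑ j, G j) / (s : ℝ) = g at *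
          nlinarith [sq_nonneg (e - 1), mul_nonneg hEβ (sub_nonneg.2 hsum)]

lemma prodExp_bernoulli (m : ℕ) (p : Fin m → ℝ) (W : (Fin m → Bool) → ℝ) :
    prodExp (fun i a => if a then p i else 1 - p i) W =
      ∑ S, prodWeight m p S * W fun i => decide (i ∈ S) := by
  unfold prodExp
  refine sum_nbij' (fun x => univ.filter fun i => x i = true) (fun S i => decide (i ∈ S))
    (by simp) (by simp) (fun x _ => by simp) (fun S _ => by simp) fun x _ => ?_
  simp only [mem_filter_univ, Bool.decide_eq_true]
  congr 1
  unfold prodWeight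
  rw [← prod_mul_prod_compl (univ.filter fun i => x i = true)]
  congr 1
  · exact prod_congr rfl fun i hi => if_pos (by simpa using hi)
  · exact prod_congr rfl fun i hi => if_neg (by simpa using hi)

lemma IsLipschitzVal.le_add_card {m : ℕ} {v : Finset (Fin m) → ℝ} (hv : IsLipschitzVal m v)
    (S D : Finset (Fin m)) : v (S ∪ D) ≤ v S + #D := by
  induction D using Finset.induction_on with
  | empty => simp
  | insert i D hi ih =>
    have h := hv (S ∪ D) i
    rw [union_insert, card_insert_of_notMem hi]
    push_cast
    linarith

/-- If `U` is covered by the sets `Y j` with each element missed by at most one of them, then a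
`q`-partitioning valuation of `U` is controlled by the values of the sets `Y j`. -/
lemma IsQPartitioning.le_of_cover {m q s : ℕ} (hs : 2 ≤ s) (hsq : s ≤ q)
    {v : Finset (Fin m) → ℝ} (hval : IsValuation m v) (hv : IsQPartitioning m q v)
    (U : Finset (Fin m)) (Y : Fin s → Finset (Fin m))
    (hU : ∀ i ∈ U, ∃ k, ∀ j, j ≠ k → i ∈ Y j) :
    v U ≤ (∑ j, v (Y j)) / (s - 1) := by
  have hs1 : (0 : ℝ) < s - 1 := by
    have : (2 : ℝ) ≤ s := by exact_mod_cast hs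
    linarith
  have hex : ∀ i, ∃ k, i ∈ U → ∀ j, j ≠ k → i ∈ Y j := fun i => by
    by_cases hi : i ∈ U
    · obtain ⟨k, hk⟩ := hU i hi
      exact ⟨k, fun _ => hk⟩
    · exact ⟨⟨0, by omega⟩, fun h => absurd h hi⟩
  choose c hc using hex
  let e : Fin s → Fin q := Fin.castLE hsq
  have he : Function.Injective e := Fin.castLE_injective hsq
  let P : Fin q → Finset (Fin m) := fun k => {i ∈ U | e (c i) = k}
  have hP : IsPartitionInto m q U P := by
    refine ⟨fun k l hkl => ?_, ?_⟩
    · rw [Finset.disjoint_left]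
      intro i hi hj
      simp only [P, mem_filter] at hi hj
      exact hkl (hi.2.symm.trans hj.2)
    · ext i
      simp [P]
  let α : Finset (Fin q) → ℝ := fun T =>
    ∑ j : Fin s, if univ.erase (e j) = T then 1 / (s - 1 : ℝ) else 0
  have hα : IsFractionalCover q α := by
    refine ⟨fun T => sum_nonneg fun j _ => by split_ifs <;> positivity, fun k => ?_⟩
    have h1 : ∑ T ∈ univ.filter (fun T : Finset (Fin q) => k ∈ T), α T =
        ∑ j : Fin s, if e j = k then 0 else 1 / (s - 1 : ℝ) := by
      rw [sum_comm]
      refine sum_congr rfl fun j _ => ?_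
      rw [sum_ite_eq]
      simp [eq_comm]
    have h2 : #{j | e j = k} ≤ 1 := card_le_one.2 fun i hi j hj => by
      simp only [mem_filter_univ] at hi hj
      exact he (hi.trans hj.symm)
    have h3 : (#{j | e j = k} : ℝ) + #{j | ¬ e j = k} = s := by
      have := card_filter_add_card_filter_not (s := (univ : Finset (Fin s))) (fun j => e j = k)
      rw [card_univ, Fintype.card_fin] at this
      exact_mod_cast this
    have h2' : (#{j | e j = k} : ℝ) ≤ 1 := by exact_mod_cast h2
    rw [h1, sum_ite, sum_const_zero, zero_add, sum_const, nsmul_eq_mul, mul_one_div,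
      le_div_iff₀ hs1]
    linarith
  refine (hv U P hP α hα).trans ?_
  have h1 : ∑ T, α T * v (T.biUnion P) =
      ∑ j : Fin s, 1 / (s - 1 : ℝ) * v ((univ.erase (e j)).biUnion P) := by
    simp only [α, sum_mul]
    rw [sum_comm]
    refine sum_congr rfl fun j _ => ?_
    simp [ite_mul]
  rw [h1, ← mul_sum, one_div_mul_eq_div]
  gcongr with j _
  refine hval.2.1 _ _ fun i hi => ?_
  simp only [P, mem_biUnion, mem_erase, mem_univ, and_true, mem_filter] at hi
  obtain ⟨k, hk, hiU, rfl⟩ := hi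
  exact hc i hiU j fun h => hk (by rw [h])

/-- The mean of a Lipschitz `q`-partitioning valuation is controlled by its median, with a free
parameter `s ≤ q` governing the trade-off between the multiplicative and additive errors. -/
theorem IsQPartitioning.mean_le {m q s : ℕ} (hs : 2 ≤ s) (hsq : s ≤ q)
    {v : Finset (Fin m) → ℝ} (hval : IsValuation m v) (hv : IsQPartitioning m q v)
    (hlip : IsLipschitzVal m v) {p : Fin m → ℝ} (hp : ∀ j, 0 ≤ p j ∧ p j ≤ 1) {a : ℝ}
    (ha : (1 / 2 : ℝ) ≤ ∑ S with v S ≤ a, prodWeight m p S) :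
    ∑ S, prodWeight m p S * v S ≤ s / (s - 1) * a + 3 * s := by
  have hs1 : (0 : ℝ) < s - 1 := by
    have : (2 : ℝ) ≤ s := by exact_mod_cast hs
    linarith
  have hs0 : (0 : ℝ) < s := by linarith
  let w : Fin m → Bool → ℝ := fun i b => if b then p i else 1 - p i
  have hw0 : ∀ i b, 0 ≤ w i b := fun i b => by
    have := hp i
    cases b <;> simp [w, this]
  have hw1 : ∀ i, ∑ b, w i b = 1 := fun i => by simp [w]
  have htotal : ∑ S, prodWeight m p S = 1 := by
    have h := Finset.prod_add p (fun j => 1 - p j) univ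
    simpa [prodWeight, compl_eq_univ_sdiff] using h.symm
  have hweight : ∀ S, 0 ≤ prodWeight m p S := fun S =>
    mul_nonneg (prod_nonneg fun j _ => (hp j).1) (prod_nonneg fun j _ => sub_nonneg.2 (hp j).2)
  let toSet : (Fin m → Bool) → Finset (Fin m) := fun x => {i | x i = true}
  have htoSet : ∀ S : Finset (Fin m), toSet (fun i => decide (i ∈ S)) = S := fun S => by
    simp [toSet]
  let A : Set (Fin m → Bool) := {x | v (toSet x) ≤ a}
  let F : Finset (Fin m) → ℝ := fun S => 1 + 1 / (3 * s) * (v S - s / (s - 1) * a)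
  have hmain := prodExp_pow_mul_prod_le_one (s := s) (by omega) m w hw0 hw1 (fun _ => A)
    (fun x => max 0 (F (toSet x))) (fun x => le_max_left _ _) fun x y hy => by
      refine max_le (by positivity) ?_
      have hbern := one_add_mul_le_pow (a := 1 / (3 * s : ℝ))
        (by linarith [show 0 < 1 / (3 * (s : ℝ)) by positivity]) (doubleMismatch x y)
      refine le_trans ?_ hbern
      let D : Finset (Fin m) := {i | ¬ ∃ k, ∀ j, j ≠ k → y j i = x i}
      have h1 : v (toSet x) ≤ v (toSet x \ D) + #D := by
        refine le_trans (hval.2.1 _ _ ?_) (hlip.le_add_card (toSet x \ D) D)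
        rw [sdiff_union_self_eq_union]
        exact subset_union_left
      have h2 : v (toSet x \ D) ≤ (∑ j, v (toSet (y j))) / (s - 1) := by
        refine hv.le_of_cover hs hsq hval _ _ fun i hi => ?_
        simp only [D, toSet, mem_sdiff, mem_filter_univ, not_not] at hi ⊢
        obtain ⟨hx, k, hk⟩ := hi
        exact ⟨k, fun j hj => (hk j hj).trans hx⟩
      have h3 : (∑ j, v (toSet (y j))) / (s - 1) ≤ s / (s - 1) * a := by
        rw [div_mul_eq_mul_div]
        gcongr
        simpa using sum_le_card_nsmul univ (fun j => v (toSet (y j))) a fun j _ => hy j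
      have h4 : #D = doubleMismatch x y := by
        unfold doubleMismatch
        convert rfl
      have h5 : v (toSet x) - s / (s - 1) * a ≤ doubleMismatch x y := by
        rw [← h4]; linarith
      simp only [F]
      rw [mul_comm (doubleMismatch x y : ℝ)]
      gcongr
  have hA : 1 / 2 ≤ prodExp w (A.indicator 1) := by
    rw [prodExp_bernoulli]
    simp only [Set.indicator_apply, A, Set.mem_ofPred_eq, htoSet, Pi.one_apply, mul_ite, mul_one,
      mul_zero]
    rwa [← sum_filter]
  have hE : prodExp w (fun x => max 0 (F (toSet x))) ≤ 2 := by
    set E := prodExp w (fun x => max 0 (F (toSet x))) with hEdef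
    have hE0 : 0 ≤ E := prodExp_nonneg hw0 fun x => le_max_left _ _
    have h1 : (E * (1 / 2)) ^ s ≤ 1 := by
      refine le_trans ?_ hmain
      rw [prod_const, card_univ, Fintype.card_fin, ← mul_pow]
      gcongr
    have h2 := (pow_le_one_iff_of_nonneg (by positivity) (by omega)).1 h1
    linarith
  rw [prodExp_bernoulli] at hE
  simp only [htoSet] at hE
  have hF : ∑ S, prodWeight m p S * F S ≤ 2 :=
    (sum_le_sum fun S _ => mul_le_mul_of_nonneg_left (le_max_right _ _) (hweight S)).trans hE
  have hFeq : ∑ S, prodWeight m p S * F S =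
      1 + 1 / (3 * s) * (∑ S, prodWeight m p S * v S - s / (s - 1) * a) := by
    calc ∑ S, prodWeight m p S * F S
        = ∑ S, (prodWeight m p S * (1 - 1 / (3 * s) * (s / (s - 1) * a)) +
            1 / (3 * s) * (prodWeight m p S * v S)) := sum_congr rfl fun S _ => by
          simp only [F]; ring
      _ = _ := by
          rw [sum_add_distrib, ← sum_mul, ← mul_sum, htotal]; ring
  rw [hFeq, one_div_mul_eq_div] at hF
  have h6 : (∑ S, prodWeight m p S * v S - s / (s - 1) * a) / (3 * s) ≤ 1 := by linarith
  rw [div_le_one (by positivity)] at h6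
  linarith

theorem qPartitioning_mean_median :
    ∃ C : ℝ, 0 < C ∧
      ∀ m q : ℕ, 2 ≤ q → q ≤ m →
        ∀ v : Finset (Fin m) → ℝ, IsValuation m v → IsQPartitioning m q v →
          IsLipschitzVal m v →
          ∀ p : Fin m → ℝ, (∀ j, 0 ≤ p j ∧ p j ≤ 1) →
            ∀ a : ℝ,
              (1 / 2 : ℝ) ≤ ∑ S ∈ Finset.univ.filter
                  (fun S : Finset (Fin m) => v S ≤ a), prodWeight m p S →
              (1 / 2 : ℝ) ≤ ∑ S ∈ Finset.univ.filter
                  (fun S : Finset (Fin m) => a ≤ v S), prodWeight m p S →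
              ∑ S : Finset (Fin m), prodWeight m p S * v S ≤
                (1 + C / Real.logb 2 (q : ℝ)) * a + C * Real.logb 2 (q : ℝ) := by
  refine ⟨6, by norm_num, fun m q hq _ v hval hv hlip p hp a ha _ => ?_⟩
  have ha0 : 0 ≤ a := by
    by_contra! hneg
    rw [filter_false_of_mem fun S _ => not_le.2 (hneg.trans_le (hval.2.2 S)), sum_empty] at ha
    norm_num at ha
  set t := Nat.log 2 q with ht
  have ht1 : 1 ≤ t := Nat.log_pos (by norm_num) hq
  have htq : t + 1 ≤ q := Nat.log_lt_self 2 (by omega)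
  have ht1' : (1 : ℝ) ≤ t := by exact_mod_cast ht1
  set L := Real.logb 2 (q : ℝ) with hL
  have hq0 : (0 : ℝ) < q := by positivity
  have htL : (t : ℝ) ≤ L := by
    rw [hL, Real.le_logb_iff_rpow_le (by norm_num) hq0, Real.rpow_natCast]
    exact_mod_cast Nat.pow_log_le_self 2 (by omega)
  have hLt : L ≤ t + 1 := by
    rw [hL, Real.logb_le_iff_le_rpow (by norm_num) hq0]
    have := (Nat.lt_pow_succ_log_self (b := 2) (by norm_num) q).le
    exact_mod_cast this
  have h := hv.mean_le (s := t + 1) (by omega) htq hval hlip hp ha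
  push_cast at h
  rw [add_sub_cancel_right] at h
  refine h.trans ?_
  have h1 : ((t : ℝ) + 1) / t ≤ 1 + 6 / L := by
    rw [add_div, div_self (by positivity)]
    gcongr 1 + ?_
    rw [div_le_div_iff₀ (by positivity) (by linarith)]
    linarith
  have h2 := mul_le_mul_of_nonneg_right h1 ha0
  linarith
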